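/- Let t be a fixed positive integer and C > 0 a constant. Suppose that there are infinitely many integers d ≥ max{3, t} for which there exists a connected d-regular simple graph with girth greater than 2t+2 on at most C·d^{t+1} vertices. Then there exist a constant c > 0 and infinitely many integers n such that some connected simple graph on n vertices has speed-t cop number at least c·n^{t/(t+1)}. -/

import Mathlib

open SimpleGraph

variable {V : Type*}

/-- The robber, moving with speed `t`, can move from `x` to `y` while the cops occupy
the vertices `cops i`: there is a path of length at most `t` from `x` to `y` that
does not pass through any cop-occupied vertex. -/
def RobberCanMove {k : ℕ} (G : SimpleGraph V) (t : ℕ) (cops : Fin k → V) (x y : V) : Prop :=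
  ∃ w : G.Walk x y, w.IsPath ∧ w.length ≤ t ∧ ∀ i : Fin k, cops i ∉ w.support

/-- A strategy for `k` cops on `G`: an initial placement, and a move function which,
given the current cop positions and the robber's position, tells each cop to stay
where he is or move to an adjacent vertex. -/
structure CopStrategy (G : SimpleGraph V) (k : ℕ) where
  init : Fin k → V
  move : (Fin k → V) → V → (Fin k → V)
  move_valid : ∀ c r i, move c r i = c i ∨ G.Adj (c i) (move c r i)

/-- The sequence of cop positions induced by a cop strategy against
a robber play `r : ℕ → V` (where `r n` is the robber's position in round `n`). -/
def copSeq {G : SimpleGraph V} {k : ℕ} (CS : CopStrategy G k) (r : ℕ → V) : ℕ → Fin k → V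
  | 0 => CS.init
  | n + 1 => CS.move (copSeq CS r n) (r n)

/-- A robber play `r` (with speed `t`) is valid against a cop strategy if, in each round,
the robber either has already been caught or moves along a path of length at most `t`
avoiding the (just moved) cops. -/
def ValidRobberPlay {k : ℕ} (G : SimpleGraph V) (t : ℕ) (CS : CopStrategy G k)
    (r : ℕ → V) : Prop :=
  ∀ n, RobberCanMove G t (copSeq CS r (n + 1)) (r n) (r (n + 1)) ∨
    ∃ i, copSeq CS r (n + 1) i = r n

/-- A cop strategy is winning (against a speed-`t` robber) if in every valid robber play a cop
eventually steps onto the robber's current vertex (or the robber is caught at the start). -/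
def CopsWin {k : ℕ} (G : SimpleGraph V) (t : ℕ) (CS : CopStrategy G k) : Prop :=
  ∀ r : ℕ → V, ValidRobberPlay G t CS r →
    (∃ i, copSeq CS r 0 i = r 0) ∨ ∃ n i, copSeq CS r (n + 1) i = r n

/-- The speed-`t` cop number of `G`: the least number of cops having a winning strategy. -/
noncomputable def copNumber (G : SimpleGraph V) (t : ℕ) : ℕ :=
  sInf { k | ∃ CS : CopStrategy G k, CopsWin G t CS }

namespace SimpleGraph

variable {G : SimpleGraph V} {t : ℕ}

/-- In a graph of large girth, a short path is determined by its endpoints. -/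
theorem Walk.IsPath.eq_of_length_add_lt_girth {u v : V} {p q : G.Walk u v} (hp : p.IsPath)
    (hq : q.IsPath) (h : p.length + q.length < G.girth) : p = q := by
  by_contra hne
  obtain ⟨w, -, -, c, hc, hle⟩ := hp.exists_isCycle_length_le_add_of_ne hq hne
  have := girth_le_length hc
  omega

theorem Connected.dist_le_dist_add_one_of_adj (hG : G.Connected) {u x z : V} (h : G.Adj x z) :
    G.dist u x ≤ G.dist u z + 1 := by
  have := hG.dist_triangle (u := u) (v := z) (w := x)
  rwa [dist_eq_one_iff_adj.2 h.symm] at this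

/-- A vertex close to `u` has at most one neighbour closer to `u` than itself. -/
theorem Connected.eq_of_adj_of_dist_lt (hG : G.Connected) (hg : 2 * t + 2 < G.girth)
    {u x z z' : V} (hx : G.dist u x ≤ t + 1) (h : G.Adj x z) (h' : G.Adj x z')
    (hz : G.dist u z < G.dist u x) (hz' : G.dist u z' < G.dist u x) : z = z' := by
  obtain ⟨p, hp⟩ := hG.exists_walk_length_eq_dist z u
  obtain ⟨p', hp'⟩ := hG.exists_walk_length_eq_dist z' u
  have e := hG.dist_le_dist_add_one_of_adj (u := u) h
  have e' := hG.dist_le_dist_add_one_of_adj (u := u) h'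
  rw [dist_comm] at hp hp'
  have hl : (Walk.cons h p).length = G.dist x u := by
    rw [Walk.length_cons, dist_comm (u := x)]; omega
  have hl' : (Walk.cons h' p').length = G.dist x u := by
    rw [Walk.length_cons, dist_comm (u := x)]; omega
  have := (Walk.isPath_of_length_eq_dist _ hl).eq_of_length_add_lt_girth
    (Walk.isPath_of_length_eq_dist _ hl') (by rw [hl, hl', dist_comm]; omega)
  simp only [Walk.cons.injEq] at this
  exact this.1

/-- Adjacent vertices close to `u` are at different distances from `u`. -/
theorem Connected.dist_ne_of_adj (hG : G.Connected) (hg : 2 * t + 2 < G.girth)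
    {u x z : V} (hx : G.dist u x ≤ t) (h : G.Adj x z) : G.dist u z ≠ G.dist u x := by
  classical
  intro he
  obtain ⟨p, hp⟩ := hG.exists_walk_length_eq_dist z u
  obtain ⟨q, hq⟩ := hG.exists_walk_length_eq_dist x u
  have hxp : x ∉ p.support := by
    intro hmem
    have h1 := congrArg Walk.length (p.take_spec hmem)
    rw [Walk.length_append] at h1
    have h2 := dist_le (p.dropUntil x hmem)
    have h3 := dist_le (p.takeUntil x hmem)
    rw [dist_eq_one_iff_adj.2 h.symm] at h3
    rw [dist_comm] at h2 hp
    omega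
  have hpath : (Walk.cons h p).IsPath :=
    (Walk.cons_isPath_iff h p).2 ⟨Walk.isPath_of_length_eq_dist _ hp, hxp⟩
  rw [dist_comm] at hp hq
  have := congrArg Walk.length <| hpath.eq_of_length_add_lt_girth
    (Walk.isPath_of_length_eq_dist _ (hq.trans dist_comm)) (by rw [Walk.length_cons]; omega)
  rw [Walk.length_cons] at this
  omega

end SimpleGraph

/-- A sum in which all terms are at most `b`, up to one exception which is at most `#S * b`. -/
theorem Finset.sum_le_two_mul_card_mul {α : Type*} (S : Finset α) (f : α → ℝ) (P : α → Prop)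
    {b : ℝ} (hb : 0 ≤ b) (hP : ∀ x ∈ S, ∀ y ∈ S, P x → P y → x = y)
    (hexc : ∀ x ∈ S, P x → f x ≤ S.card * b) (hle : ∀ x ∈ S, ¬ P x → f x ≤ b) :
    ∑ x ∈ S, f x ≤ S.card * (2 * b) := by
  classical
  have hcard : (S.filter P).card ≤ 1 :=
    Finset.card_le_one.2 fun x hx y hy => by
      rw [Finset.mem_filter] at hx hy
      exact hP x hx.1 y hy.1 hx.2 hy.2
  have h1 : ∑ x ∈ S with P x, f x ≤ S.card * b := by
    refine (Finset.sum_le_card_nsmul _ _ (S.card * b) fun x hx => ?_).trans ?_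
    · rw [Finset.mem_filter] at hx
      exact hexc x hx.1 hx.2
    · rw [nsmul_eq_mul]
      exact mul_le_of_le_one_left (by positivity) (by exact_mod_cast hcard)
  have h2 : ∑ x ∈ S with ¬ P x, f x ≤ S.card * b := by
    refine (Finset.sum_le_card_nsmul _ _ b fun x hx => ?_).trans ?_
    · rw [Finset.mem_filter] at hx
      exact hle x hx.1 hx.2
    · rw [nsmul_eq_mul]
      gcongr
      exact Finset.filter_subset _ _
  rw [← Finset.sum_filter_add_sum_filter_not S P]
  linarith

namespace SimpleGraph

/-- Bounds, up to a power of two, the probability that a non-backtracking random walk which is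
now at `x` ever meets the cop at `u`. -/
noncomputable def hitWeight (G : SimpleGraph V) (q : ℝ) (t : ℕ) (u x : V) : ℝ :=
  q ^ min (G.dist u x) (t + 1)

/-- Bounds, up to a power of two, the expected threat posed by the cop at `u` at the end of a
non-backtracking random walk that avoids `u`, has just moved from `y` to `x`, and has `r` steps
left. -/
noncomputable def threatWeight (G : SimpleGraph V) (q : ℝ) (t r : ℕ) (u y x : V) : ℝ :=
  if G.dist u y < G.dist u x then q ^ min t (G.dist u x + r - 1)
  else q ^ min t (max r (G.dist u x - 1))

variable {G : SimpleGraph V} {t : ℕ} {q : ℝ}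

theorem hitWeight_nonneg (hq : 0 ≤ q) (u x : V) : 0 ≤ G.hitWeight q t u x := by
  unfold hitWeight; positivity

theorem threatWeight_nonneg (hq : 0 ≤ q) (r : ℕ) (u y x : V) :
    0 ≤ G.threatWeight q t r u y x := by
  unfold threatWeight; split <;> positivity

theorem sum_hitWeight_le (hG : G.Connected) (hg : 2 * t + 2 < G.girth) (hq0 : 0 ≤ q)
    (hq1 : q ≤ 1) {u x : V} (hux : u ≠ x) (S : Finset V) (hS : ∀ z ∈ S, G.Adj x z)
    (hSq : S.card * q = 1) :
    ∑ z ∈ S, G.hitWeight q t u z ≤ S.card * (2 * G.hitWeight q t u x) := by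
  have hpos := hG.pos_dist_of_ne hux
  refine S.sum_le_two_mul_card_mul _ (fun z => G.dist u z < G.dist u x ∧ G.dist u x ≤ t + 1)
    (hitWeight_nonneg hq0 u x) ?_ ?_ ?_
  · exact fun z hz z' hz' h h' => hG.eq_of_adj_of_dist_lt hg h.2 (hS z hz) (hS z' hz') h.1 h'.1
  · rintro z hz ⟨h, h'⟩
    have := hG.dist_le_dist_add_one_of_adj (u := u) (hS z hz)
    unfold hitWeight
    rw [min_eq_left h', show G.dist u x = G.dist u z + 1 by omega, min_eq_left (by omega),
      pow_succ', ← mul_assoc, hSq, one_mul]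
  · intro z hz h
    have := hG.dist_le_dist_add_one_of_adj (u := u) (hS z hz)
    exact pow_le_pow_of_le_one hq0 hq1 (by omega)

theorem sum_threatWeight_le (ht : 0 < t) (hG : G.Connected) (hg : 2 * t + 2 < G.girth)
    (hq0 : 0 ≤ q) (hq1 : q ≤ 1) {u x y : V} (hux : u ≠ x) (hxy : G.Adj x y) (S : Finset V)
    (hS : ∀ z ∈ S, G.Adj x z) (hyS : y ∉ S) (hSq : S.card * q = 1) (r : ℕ) :
    ∑ z ∈ S, G.threatWeight q t r u x z ≤
      S.card * (2 * G.threatWeight q t (r + 1) u y x) := by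
  have hpos := hG.pos_dist_of_ne hux
  have hone : ∀ a b : ℕ, b ≤ a + 1 → q ^ a ≤ S.card * q ^ b := by
    intro a b hab
    calc q ^ a = S.card * q ^ (a + 1) := by rw [pow_succ', ← mul_assoc, hSq, one_mul]
      _ ≤ _ := mul_le_mul_of_nonneg_left (pow_le_pow_of_le_one hq0 hq1 hab) (by positivity)
  have hstep : ∀ z ∈ S, G.dist u x ≤ G.dist u z + 1 ∧ G.dist u z ≤ G.dist u x + 1 := fun z hz =>
    ⟨hG.dist_le_dist_add_one_of_adj (hS z hz), hG.dist_le_dist_add_one_of_adj (hS z hz).symm⟩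
  have hne : G.dist u x ≤ t → ∀ z ∈ S, G.dist u z ≠ G.dist u x := fun h z hz =>
    hG.dist_ne_of_adj hg h (hS z hz)
  have hback : G.dist u x ≤ t + 1 → G.dist u y < G.dist u x → ∀ z ∈ S,
      ¬ G.dist u z < G.dist u x := fun h hy z hz hlt =>
    hyS (hG.eq_of_adj_of_dist_lt hg h hxy (hS z hz) hy hlt ▸ hz)
  refine S.sum_le_two_mul_card_mul _ (fun z => G.dist u z < G.dist u x ∧ G.dist u x ≤ t + 1)
    (threatWeight_nonneg hq0 _ _ _ _) ?_ ?_ ?_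
  · exact fun z hz z' hz' h h' => hG.eq_of_adj_of_dist_lt hg h.2 (hS z hz) (hS z' hz') h.1 h'.1
  · rintro z hz ⟨h, h'⟩
    have hy : ¬ G.dist u y < G.dist u x := fun hy => hback h' hy z hz h
    have := hstep z hz
    unfold threatWeight
    rw [if_neg hy, if_neg (by omega)]
    exact hone _ _ (by omega)
  · intro z hz h
    have := hstep z hz
    have := fun hh => hne hh z hz
    unfold threatWeight
    split_ifs with h1 h2 h2 <;> exact pow_le_pow_of_le_one hq0 hq1 (by omega)

end SimpleGraph

section Evasion

variable {G : SimpleGraph V} {t : ℕ} {q : ℝ}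

theorem cop_ne_of_weight_lt_one {k : ℕ} (hq0 : 0 ≤ q) {μ : ℝ} (hμ : 0 ≤ μ) (c : Fin k → V)
    (r : ℕ) (y x : V)
    (hlt : ∑ i, 2 ^ r * (G.hitWeight q t (c i) x + μ * G.threatWeight q t r (c i) y x) < 1)
    (i : Fin k) : c i ≠ x := by
  intro hi
  refine hlt.not_ge ?_
  have hnn : ∀ j, 0 ≤ μ * G.threatWeight q t r (c j) y x := fun j =>
    mul_nonneg hμ (threatWeight_nonneg hq0 _ _ _ _)
  have hone : G.hitWeight q t (c i) x = 1 := by simp [hitWeight, hi]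
  calc (1 : ℝ) ≤ 2 ^ r * (G.hitWeight q t (c i) x + μ * G.threatWeight q t r (c i) y x) :=
        one_le_mul_of_one_le_of_one_le (one_le_pow₀ one_le_two) (by linarith [hnn i])
    _ ≤ _ := Finset.single_le_sum
        (f := fun i => 2 ^ r * (G.hitWeight q t (c i) x + μ * G.threatWeight q t r (c i) y x))
        (fun j _ => mul_nonneg (by positivity) (add_nonneg (hitWeight_nonneg hq0 _ _) (hnn j)))
        (Finset.mem_univ i)

/-- If the total weight of the cops is less than one, then the robber can walk `r` steps avoiding
all cops and end at a vertex where the total threat is small. -/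
theorem exists_walk_avoiding [Fintype V] [DecidableEq V] [DecidableRel G.Adj] {d k : ℕ}
    (ht : 0 < t) (hG : G.Connected) (hg : 2 * t + 2 < G.girth)
    (hreg : G.IsRegularOfDegree (d + 1)) (hd : 0 < d) {μ : ℝ} (hμ : 0 ≤ μ) (c : Fin k → V)
    (r : ℕ) (y x : V) (hxy : G.Adj x y)
    (hlt : ∑ i, 2 ^ r * (G.hitWeight (d : ℝ)⁻¹ t (c i) x +
      μ * G.threatWeight (d : ℝ)⁻¹ t r (c i) y x) < 1) :
    ∃ (w : V) (p : G.Walk x w), p.length ≤ r ∧ (∀ i, c i ∉ p.support) ∧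
      μ * ∑ i, (d : ℝ)⁻¹ ^ min t (G.dist (c i) w - 1) < 1 := by
  set q : ℝ := (d : ℝ)⁻¹ with hq
  have hd1 : (1 : ℝ) ≤ d := by exact_mod_cast hd
  have hq0 : 0 ≤ q := by positivity
  have hq1 : q ≤ 1 := inv_le_one_of_one_le₀ hd1
  induction r generalizing y x with
  | zero =>
    have hcx := cop_ne_of_weight_lt_one hq0 hμ c 0 y x hlt
    refine ⟨x, .nil, le_rfl, by simpa using hcx, lt_of_le_of_lt ?_ hlt⟩
    rw [Finset.mul_sum]
    refine Finset.sum_le_sum fun i _ => ?_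
    have h1 : q ^ min t (G.dist (c i) x - 1) = G.threatWeight q t 0 (c i) y x := by
      unfold threatWeight; simp
    rw [pow_zero, one_mul, h1]
    linarith [hitWeight_nonneg (G := G) (t := t) hq0 (c i) x]
  | succ r ih =>
    have hcx := cop_ne_of_weight_lt_one hq0 hμ c (r + 1) y x hlt
    set S := (G.neighborFinset x).erase y
    have hcard : S.card = d := by
      rw [Finset.card_erase_of_mem (by simpa using hxy), G.card_neighborFinset_eq_degree, hreg x]
      rfl
    have hS : ∀ z ∈ S, G.Adj x z := fun z hz => by
      simpa using Finset.mem_of_mem_erase hz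
    have hSq : (S.card : ℝ) * q = 1 := by
      rw [hcard, hq]; exact mul_inv_cancel₀ (by positivity)
    have hsum : ∑ z ∈ S, ∑ i, 2 ^ r * (G.hitWeight q t (c i) z +
        μ * G.threatWeight q t r (c i) x z) < ∑ z ∈ S, (1 : ℝ) := by
      rw [Finset.sum_comm, Finset.sum_const, nsmul_one]
      calc ∑ i, ∑ z ∈ S, 2 ^ r * (G.hitWeight q t (c i) z + μ * G.threatWeight q t r (c i) x z)
          ≤ ∑ i, S.card * (2 ^ (r + 1) * (G.hitWeight q t (c i) x +
              μ * G.threatWeight q t (r + 1) (c i) y x)) := by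
            refine Finset.sum_le_sum fun i _ => ?_
            rw [← Finset.mul_sum, Finset.sum_add_distrib, ← Finset.mul_sum]
            have h1 := sum_hitWeight_le hG hg hq0 hq1 (hcx i) S hS hSq
            have h2 := sum_threatWeight_le ht hG hg hq0 hq1 (hcx i) hxy S hS
              (Finset.notMem_erase _ _) hSq r
            calc _ ≤ 2 ^ r * (S.card * (2 * G.hitWeight q t (c i) x) +
                    μ * (S.card * (2 * G.threatWeight q t (r + 1) (c i) y x))) := by gcongr
              _ = _ := by ring
        _ = S.card * ∑ i, 2 ^ (r + 1) * (G.hitWeight q t (c i) x +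
              μ * G.threatWeight q t (r + 1) (c i) y x) := by rw [Finset.mul_sum]
        _ < S.card := mul_lt_of_lt_one_right (by rw [hcard]; positivity) hlt
    obtain ⟨z, hz, hzlt⟩ := Finset.exists_lt_of_sum_lt hsum
    obtain ⟨w, p, hp, hcp, hw⟩ := ih x z (hS z hz).symm hzlt
    refine ⟨w, .cons (hS z hz) p, by simpa using hp, fun i => ?_, hw⟩
    simpa using ⟨hcx i, hcp i⟩

/-- The robber, at a vertex where the threat is small, can answer any move of the cops. -/
theorem exists_robber_move [Fintype V] [DecidableEq V] [DecidableRel G.Adj] {d k : ℕ}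
    (ht : 0 < t) (hG : G.Connected) (hg : 2 * t + 2 < G.girth)
    (hreg : G.IsRegularOfDegree (d + 1)) (hd : 0 < d) (hk : k * 2 ^ (2 * t + 2) ≤ d ^ t)
    (c c' : Fin k → V) (hc : ∀ i, c' i = c i ∨ G.Adj (c i) (c' i)) (v : V)
    (hv : (2 : ℝ) ^ (t + 1) * ∑ i, (d : ℝ)⁻¹ ^ min t (G.dist (c i) v - 1) < 1) :
    (∀ i, c' i ≠ v) ∧ ∃ w, RobberCanMove G t c' v w ∧
      (2 : ℝ) ^ (t + 1) * ∑ i, (d : ℝ)⁻¹ ^ min t (G.dist (c' i) w - 1) < 1 := by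
  set q : ℝ := (d : ℝ)⁻¹ with hq
  have hd1 : (1 : ℝ) ≤ d := by exact_mod_cast hd
  have hq0 : 0 ≤ q := by positivity
  have hq1 : q ≤ 1 := inv_le_one_of_one_le₀ hd1
  have hdist : ∀ i, G.dist (c i) v ≤ G.dist (c' i) v + 1 := by
    intro i
    rcases hc i with h | h
    · rw [h]; omega
    · simpa only [G.dist_comm (v := v)] using hG.dist_le_dist_add_one_of_adj (u := v) h
  have hfar : ∀ i, 2 ≤ G.dist (c i) v := by
    intro i
    by_contra! hlt
    have h1 : q ^ min t (G.dist (c i) v - 1) ≤ ∑ i, q ^ min t (G.dist (c i) v - 1) :=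
      Finset.single_le_sum (f := fun i => q ^ min t (G.dist (c i) v - 1))
        (fun i _ => by positivity) (Finset.mem_univ i)
    rw [show min t (G.dist (c i) v - 1) = 0 by omega, pow_zero] at h1
    have h2 : (1 : ℝ) ≤ 2 ^ (t + 1) := one_le_pow₀ one_le_two
    nlinarith
  have hne : ∀ i, c' i ≠ v := by
    intro i hi
    have := hdist i
    have := hfar i
    rw [hi, dist_self] at *
    omega
  refine ⟨hne, ?_⟩
  obtain ⟨y, hy⟩ : ∃ y, G.Adj v y := by
    rw [← G.degree_pos_iff_exists_adj, hreg v]; omega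
  have hstart : ∑ i, 2 ^ t * (G.hitWeight q t (c' i) v +
      2 ^ (t + 1) * G.threatWeight q t t (c' i) y v) < 1 := by
    have hbound : ∀ i, 2 ^ t * (G.hitWeight q t (c' i) v +
        2 ^ (t + 1) * G.threatWeight q t t (c' i) y v) ≤
        2 ^ t * q ^ min t (G.dist (c i) v - 1) + 2 ^ (2 * t + 1) * q ^ t := by
      intro i
      have h1 : G.hitWeight q t (c' i) v ≤ q ^ min t (G.dist (c i) v - 1) := by
        have := hdist i
        exact pow_le_pow_of_le_one hq0 hq1 (by omega)
      have h2 : G.threatWeight q t t (c' i) y v ≤ q ^ t := by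
        have := hdist i
        have := hfar i
        unfold threatWeight
        split <;> exact pow_le_pow_of_le_one hq0 hq1 (by omega)
      calc _ ≤ 2 ^ t * (q ^ min t (G.dist (c i) v - 1) + 2 ^ (t + 1) * q ^ t) := by gcongr
        _ = _ := by ring
    have hkq : (k : ℝ) * 2 ^ (2 * t + 2) * q ^ t ≤ 1 := by
      rw [hq, inv_pow, mul_inv_le_iff₀ (by positivity), one_mul]
      exact_mod_cast hk
    refine (Finset.sum_le_sum fun i _ => hbound i).trans_lt ?_
    rw [Finset.sum_add_distrib, ← Finset.mul_sum, Finset.sum_const, Finset.card_univ,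
      Fintype.card_fin, nsmul_eq_mul]
    have e1 : (2 : ℝ) ^ (t + 1) = 2 * 2 ^ t := pow_succ' _ _
    have e2 : (2 : ℝ) ^ (2 * t + 2) = 2 * 2 ^ (2 * t + 1) := pow_succ' _ _
    rw [e1] at hv
    rw [e2] at hkq
    linarith
  obtain ⟨w, p, hp, hcp, hw⟩ :=
    exists_walk_avoiding ht hG hg hreg hd (by positivity) c' t y v hy hstart
  exact ⟨w, ⟨p.bypass, p.bypass_isPath, p.length_bypass_le_length.trans hp,
    fun i hi => hcp i (p.support_bypass_subset_support hi)⟩, hw⟩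

end Evasion

/-- A robber who starts at a position satisfying an invariant and can keep it forever beats every
cop strategy. -/
theorem not_copsWin_of_invariant {G : SimpleGraph V} {t k : ℕ} (CS : CopStrategy G k)
    (I : (Fin k → V) → V → Prop) (v : V) (hv : I CS.init v) (hv' : ∀ i, CS.init i ≠ v)
    (hstep : ∀ c x, I c x → (∀ i, CS.move c x i ≠ x) ∧
      ∃ w, RobberCanMove G t (CS.move c x) x w ∧ I (CS.move c x) w) :
    ¬ CopsWin G t CS := by
  choose hsafe next hmove hI using hstep
  let s : ℕ → {p : (Fin k → V) × V // I p.1 p.2} := fun n =>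
    n.rec ⟨(CS.init, v), hv⟩ fun _ p =>
      ⟨(CS.move p.1.1 p.1.2, next p.1.1 p.1.2 p.2), hI _ _ p.2⟩
  have hseq : ∀ n, copSeq CS (fun n => (s n).1.2) n = (s n).1.1 := by
    intro n
    induction n with
    | zero => rfl
    | succ n ih => rw [copSeq, ih]
  have hvalid : ValidRobberPlay G t CS fun n => (s n).1.2 := fun n => Or.inl <| by
    rw [hseq]
    exact hmove _ _ (s n).2
  intro hwin
  rcases hwin _ hvalid with ⟨i, hi⟩ | ⟨n, i, hi⟩
  · exact hv' i hi
  · rw [hseq] at hi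
    exact hsafe _ _ (s n).2 i hi

theorem copNumber_mem [Fintype V] (G : SimpleGraph V) (t : ℕ) :
    ∃ CS : CopStrategy G (copNumber G t), CopsWin G t CS := by
  refine Nat.sInf_mem (s := {k | ∃ CS : CopStrategy G k, CopsWin G t CS})
    ⟨Fintype.card V, ⟨(Fintype.equivFin V).symm, fun c _ => c, fun _ _ _ => Or.inl rfl⟩, ?_⟩
  exact fun r _ => Or.inl ⟨Fintype.equivFin V (r 0), by simp [copSeq]⟩

section Counting

variable [Fintype V] [DecidableEq V] {G : SimpleGraph V} [DecidableRel G.Adj] {t d : ℕ}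

theorem card_sphere_le (hG : G.Connected) (hreg : G.IsRegularOfDegree d) (u : V) (j : ℕ) :
    (Finset.univ.filter fun x => G.dist u x = j).card ≤ d ^ j := by
  induction j with
  | zero =>
    rw [pow_zero, Finset.card_le_one]
    simp only [Finset.mem_filter, Finset.mem_univ, true_and, hG.dist_eq_zero_iff]
    rintro x rfl y rfl
    rfl
  | succ j ih =>
    have hsub : (Finset.univ.filter fun x => G.dist u x = j + 1) ⊆
        (Finset.univ.filter fun x => G.dist u x = j).biUnion fun x => G.neighborFinset x := by
      intro x hx
      simp only [Finset.mem_filter, Finset.mem_univ, true_and] at hx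
      obtain ⟨p, hp⟩ := hG.exists_walk_length_eq_dist x u
      rw [dist_comm, hx] at hp
      cases p with
      | nil => simp at hp
      | @cons _ z _ h p =>
        rw [Walk.length_cons] at hp
        have h1 := dist_le p
        rw [dist_comm] at h1
        have h2 := hG.dist_le_dist_add_one_of_adj (u := u) h
        simp only [Finset.mem_biUnion, Finset.mem_filter, Finset.mem_univ, true_and,
          mem_neighborFinset]
        exact ⟨z, by omega, h.symm⟩
    calc _ ≤ _ := Finset.card_le_card hsub
      _ ≤ _ * d := Finset.card_biUnion_le_card_mul _ _ _ fun x _ => by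
        rw [G.card_neighborFinset_eq_degree, hreg x]
      _ ≤ _ := by rw [pow_succ]; gcongr

theorem le_card_sphere (hG : G.Connected) (hg : 2 * t + 2 < G.girth)
    (hreg : G.IsRegularOfDegree (d + 1)) (u : V) (j : ℕ) (hj : j ≤ t + 1) :
    d ^ j ≤ (Finset.univ.filter fun x => G.dist u x = j).card := by
  induction j with
  | zero =>
    rw [pow_zero, Nat.one_le_iff_ne_zero, Finset.card_ne_zero]
    exact ⟨u, by simp⟩
  | succ j ih =>
    have key := Finset.card_mul_le_card_mul (m := d) (n := 1) G.Adj
      (s := Finset.univ.filter fun x => G.dist u x = j)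
      (t := Finset.univ.filter fun x => G.dist u x = j + 1) ?_ ?_
    · calc d ^ (j + 1) = d ^ j * d := pow_succ _ _
        _ ≤ _ * d := Nat.mul_le_mul_right _ (ih (by omega))
        _ ≤ _ := by simpa using key
    · intro x hx
      simp only [Finset.mem_filter, Finset.mem_univ, true_and] at hx
      have hclose : ((G.neighborFinset x).filter fun z => G.dist u z < G.dist u x).card ≤ 1 :=
        Finset.card_le_one.2 fun z hz z' hz' => by
          simp only [Finset.mem_filter, mem_neighborFinset] at hz hz'
          exact hG.eq_of_adj_of_dist_lt hg (by omega) hz.1 hz'.1 hz.2 hz'.2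
      have hsplit := Finset.card_filter_add_card_filter_not (s := G.neighborFinset x)
        (fun z => G.dist u z < G.dist u x)
      rw [G.card_neighborFinset_eq_degree, hreg x] at hsplit
      have hsub : ((G.neighborFinset x).filter fun z => ¬ G.dist u z < G.dist u x) ⊆
          (Finset.univ.filter fun x => G.dist u x = j + 1).bipartiteAbove G.Adj x := by
        intro z hz
        simp only [Finset.mem_filter, mem_neighborFinset] at hz
        have h1 := hG.dist_ne_of_adj hg (u := u) (by omega) hz.1
        have h2 := hG.dist_le_dist_add_one_of_adj (u := u) hz.1.symm
        simp only [Finset.mem_bipartiteAbove, Finset.mem_filter, Finset.mem_univ, true_and]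
        exact ⟨by omega, hz.1⟩
      have := Finset.card_le_card hsub
      omega
    · intro z hz
      simp only [Finset.mem_filter, Finset.mem_univ, true_and] at hz
      refine Finset.card_le_one.2 fun x hx x' hx' => ?_
      simp only [Finset.mem_bipartiteBelow, Finset.mem_filter, Finset.mem_univ, true_and]
        at hx hx'
      exact hG.eq_of_adj_of_dist_lt hg (u := u) (by omega) hx.2.symm hx'.2.symm
        (by omega) (by omega)

/-- A single cop threatens only a small proportion of the vertices. -/
theorem sum_threat_le (hG : G.Connected) (hg : 2 * t + 2 < G.girth)
    (hreg : G.IsRegularOfDegree (d + 1)) (hd : 0 < d) (u : V) :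
    ∑ x, (d : ℝ)⁻¹ ^ min t (G.dist u x - 1) ≤
      ((t + 1) * 2 ^ t + 1) * (Fintype.card V * (d : ℝ)⁻¹ ^ t) := by
  set q : ℝ := (d : ℝ)⁻¹ with hq
  have hd1 : (1 : ℝ) ≤ d := by exact_mod_cast hd
  have hq0 : 0 ≤ q := by positivity
  have hdq : (d : ℝ) * q = 1 := mul_inv_cancel₀ (by positivity)
  have hcard : (d : ℝ) ≤ Fintype.card V * q ^ t := by
    have h1 : d ^ (t + 1) ≤ Fintype.card V :=
      (le_card_sphere hG hg hreg u (t + 1) le_rfl).trans (Finset.card_le_univ _)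
    have h2 : (d : ℝ) ^ (t + 1) ≤ Fintype.card V := by exact_mod_cast h1
    calc (d : ℝ) = d ^ (t + 1) * q ^ t := by
          rw [pow_succ', mul_assoc, ← mul_pow, hdq, one_pow, mul_one]
      _ ≤ _ := by gcongr
  have hpt : ∀ x, q ^ min t (G.dist u x - 1) ≤
      ∑ j ∈ Finset.range (t + 1), (if G.dist u x = j then q ^ (j - 1) else 0) + q ^ t := by
    intro x
    have hnn : 0 ≤ q ^ t := by positivity
    rw [Finset.sum_ite_eq]
    split_ifs with h
    · rw [Finset.mem_range] at h
      rw [min_eq_right (by omega)]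
      linarith
    · rw [Finset.mem_range] at h
      rw [min_eq_left (by omega)]
      linarith
  have hsphere : ∀ j ∈ Finset.range (t + 1),
      ∑ x, (if G.dist u x = j then q ^ (j - 1) else 0) ≤ 2 ^ t * d := by
    intro j hj
    rw [Finset.mem_range] at hj
    rw [← Finset.sum_filter, Finset.sum_const, nsmul_eq_mul]
    have h1 : ((Finset.univ.filter fun x => G.dist u x = j).card : ℝ) ≤ (2 * d) ^ j := by
      have := (card_sphere_le hG hreg u j).trans
        (Nat.pow_le_pow_left (show d + 1 ≤ 2 * d by omega) j)
      exact_mod_cast this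
    refine (mul_le_mul_of_nonneg_right h1 (by positivity)).trans ?_
    cases j with
    | zero =>
      simpa using one_le_mul_of_one_le_of_one_le (one_le_pow₀ one_le_two) hd1
    | succ j =>
      calc ((2 : ℝ) * d) ^ (j + 1) * q ^ j = 2 ^ (j + 1) * (d * (d * q) ^ j) := by ring
        _ = 2 ^ (j + 1) * d := by rw [hdq, one_pow, mul_one]
        _ ≤ 2 ^ t * d := by
          gcongr
          · exact one_le_two
          · omega
  calc ∑ x, q ^ min t (G.dist u x - 1)
      ≤ ∑ x, (∑ j ∈ Finset.range (t + 1), (if G.dist u x = j then q ^ (j - 1) else 0) + q ^ t) :=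
        Finset.sum_le_sum fun x _ => hpt x
    _ = ∑ j ∈ Finset.range (t + 1), ∑ x, (if G.dist u x = j then q ^ (j - 1) else 0) +
          Fintype.card V * q ^ t := by
        rw [Finset.sum_add_distrib, Finset.sum_comm, Finset.sum_const, Finset.card_univ,
          nsmul_eq_mul]
    _ ≤ (t + 1) * (2 ^ t * d) + Fintype.card V * q ^ t := by
        gcongr
        refine (Finset.sum_le_sum hsphere).trans_eq ?_
        rw [Finset.sum_const, Finset.card_range, nsmul_eq_mul]
        push_cast
        rfl
    _ ≤ (t + 1) * (2 ^ t * (Fintype.card V * q ^ t)) + Fintype.card V * q ^ t := by gcongr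
    _ = _ := by ring

/-- A connected `(d+1)`-regular graph of girth greater than `2t+2` has speed-`t` cop number at
least a constant multiple of `d^t`. -/
theorem pow_le_copNumber_mul (ht : 0 < t) (hG : G.Connected) (hg : 2 * t + 2 < G.girth)
    (hreg : G.IsRegularOfDegree (d + 1)) (hd : 0 < d) :
    d ^ t ≤ copNumber G t * (2 ^ (2 * t + 2) * ((t + 1) * 2 ^ t + 1)) := by
  obtain ⟨CS, hCS⟩ := copNumber_mem G t
  generalize copNumber G t = k at CS hCS
  by_contra! hlt
  have := hG.nonempty
  have hd1 : (1 : ℝ) ≤ d := by exact_mod_cast hd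
  have hk : k * 2 ^ (2 * t + 2) ≤ d ^ t := by
    refine le_trans ?_ hlt.le
    rw [← mul_assoc]
    exact Nat.le_mul_of_pos_right _ (by positivity)
  have hk' : (k : ℝ) * (2 ^ (t + 1) * ((t + 1) * 2 ^ t + 1)) * (d : ℝ)⁻¹ ^ t < 1 := by
    rw [inv_pow, mul_inv_lt_iff₀ (by positivity), one_mul]
    have h1 : (k : ℝ) * (2 ^ (2 * t + 2) * ((t + 1) * 2 ^ t + 1)) < d ^ t := by
      exact_mod_cast hlt
    have h2 : (2 : ℝ) ^ (t + 1) ≤ 2 ^ (2 * t + 2) := pow_le_pow_right₀ one_le_two (by omega)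
    refine lt_of_le_of_lt ?_ h1
    exact mul_le_mul_of_nonneg_left (mul_le_mul_of_nonneg_right h2 (by positivity)) (by positivity)
  obtain ⟨v, -, hv⟩ : ∃ v ∈ Finset.univ,
      (2 : ℝ) ^ (t + 1) * ∑ i, (d : ℝ)⁻¹ ^ min t (G.dist (CS.init i) v - 1) < 1 := by
    refine Finset.exists_lt_of_sum_lt ?_
    rw [← Finset.mul_sum, Finset.sum_comm, Finset.sum_const, nsmul_one, Finset.card_univ]
    have hn : (0 : ℝ) < Fintype.card V := by exact_mod_cast Fintype.card_pos
    calc _ ≤ (2 : ℝ) ^ (t + 1) * ∑ _i : Fin k,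
            ((t + 1) * 2 ^ t + 1) * (Fintype.card V * (d : ℝ)⁻¹ ^ t) := by
          gcongr with i
          exact sum_threat_le hG hg hreg hd _
      _ = k * (2 ^ (t + 1) * ((t + 1) * 2 ^ t + 1)) * (d : ℝ)⁻¹ ^ t * Fintype.card V := by
          rw [Finset.sum_const, Finset.card_univ, Fintype.card_fin, nsmul_eq_mul]
          ring
      _ < Fintype.card V := mul_lt_of_lt_one_left hn hk'
  refine not_copsWin_of_invariant CS
    (fun c x => (2 : ℝ) ^ (t + 1) * ∑ i, (d : ℝ)⁻¹ ^ min t (G.dist (c i) x - 1) < 1) v hv ?_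
    (fun c x hx => exists_robber_move ht hG hg hreg hd hk c _ (CS.move_valid c x) x hx) hCS
  exact (exists_robber_move ht hG hg hreg hd hk CS.init CS.init (fun _ => Or.inl rfl) v hv).1

end Counting

/-- If for infinitely many `d ≥ max 3 t` there is a connected `d`-regular
graph of girth greater than `2t+2` on at most `C·d^(t+1)` vertices, then there are infinitely
many `n` admitting a connected `n`-vertex graph with speed-`t` cop number at least
`c·n^(t/(t+1))`, for some constant `c > 0`. -/
theorem stmt16 (t : ℕ) (ht : 0 < t) (C : ℝ) (hC : 0 < C)
    (hcages : {d : ℕ | max 3 t ≤ d ∧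
        ∃ (n : ℕ) (G : SimpleGraph (Fin n)) (_ : DecidableRel G.Adj),
          G.Connected ∧ G.IsRegularOfDegree d ∧ (2 * t + 2 : ℕ∞) < G.girth ∧
            (n : ℝ) ≤ C * (d : ℝ) ^ (t + 1)}.Infinite) :
    ∃ c : ℝ, 0 < c ∧
      {n : ℕ | ∃ G : SimpleGraph (Fin n), G.Connected ∧
          c * (n : ℝ) ^ ((t : ℝ) / (t + 1)) ≤ (copNumber G t : ℝ)}.Infinite := by
  set K : ℕ := 2 ^ (2 * t + 2) * ((t + 1) * 2 ^ t + 1)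
  set e : ℝ := (t : ℝ) / (t + 1) with he
  have hK0 : (0 : ℝ) < K := by positivity
  have hCe : 0 < C ^ e := Real.rpow_pos_of_pos hC e
  refine ⟨(C ^ e * (2 ^ t * K))⁻¹, by positivity, ?_⟩
  refine Set.infinite_of_forall_exists_gt fun N => ?_
  obtain ⟨d, ⟨hd, n, G, _, hG, hreg, hg, hn⟩, hNd⟩ := hcages.exists_gt N
  obtain ⟨D, rfl⟩ : ∃ D, d = D + 1 := ⟨d - 1, by omega⟩
  have hD : 0 < D := by omega
  refine ⟨n, ⟨G, hG, ?_⟩, ?_⟩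
  · have hmain := pow_le_copNumber_mul ht hG (by exact_mod_cast hg) hreg hD
    have hmain' : (D : ℝ) ^ t ≤ copNumber G t * K := by exact_mod_cast hmain
    have hD2 : ((D + 1 : ℕ) : ℝ) ≤ 2 * D := by exact_mod_cast (by omega : D + 1 ≤ 2 * D)
    have hpow : (n : ℝ) ^ e ≤ C ^ e * ((D + 1 : ℕ) : ℝ) ^ t := by
      calc (n : ℝ) ^ e ≤ (C * ((D + 1 : ℕ) : ℝ) ^ (t + 1)) ^ e :=
            Real.rpow_le_rpow (by positivity) hn (by positivity)
        _ = _ := by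
            rw [Real.mul_rpow hC.le (by positivity), ← Real.rpow_natCast, ← Real.rpow_mul
              (by positivity), ← Real.rpow_natCast]
            congr 2
            rw [he]
            push_cast
            field_simp
    rw [inv_mul_le_iff₀ (by positivity)]
    calc (n : ℝ) ^ e ≤ C ^ e * ((D + 1 : ℕ) : ℝ) ^ t := hpow
      _ ≤ C ^ e * (2 * D) ^ t := by gcongr
      _ = C ^ e * 2 ^ t * (D : ℝ) ^ t := by ring
      _ ≤ C ^ e * 2 ^ t * (copNumber G t * K) := by gcongr
      _ = _ := by ring
  · have := hG.nonempty
    have hlt := G.degree_lt_card_verts (Classical.arbitrary (Fin n))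
    rw [hreg, Fintype.card_fin] at hlt
    omega
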